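/- (a) S_n/n converges in distribution, as n → ∞, to the three-point distribution taking the value 2p−1 with probability p², the value 0 with probability 1−p, and the value −(2p−1) with probability p(1−p). (b) E(S_n/n) → p(2p−1)² and Var(S_n/n) → p(1−p)(2p−1)²(4p²+1) as n → ∞. -/

import Mathlib

open MeasureTheory ProbabilityTheory Filter Topology

noncomputable section

/-- The σ-algebra generated by the steps `X 1, …, X n`. -/
def sigmaUpTo {Ω : Type*} (X : ℕ → Ω → ℝ) (n : ℕ) : MeasurableSpace Ω :=
  ⨆ i ∈ Finset.Icc 1 n, MeasurableSpace.comap (X i) inferInstance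

/-- The σ-algebra generated by all the steps `X 1, X 2, …`. -/
def sigmaAll {Ω : Type*} (X : ℕ → Ω → ℝ) : MeasurableSpace Ω :=
  ⨆ i ∈ Set.Ici 1, MeasurableSpace.comap (X i) inferInstance

/-- The partial sum `X 1 + ⋯ + X n` of the walk. -/
def partialSum {Ω : Type*} (X : ℕ → Ω → ℝ) (n : ℕ) (ω : Ω) : ℝ :=
  ∑ k ∈ Finset.Icc 1 n, X k ω

/-- Convergence in distribution of the random variables `f n` to the law `ν`,
expressed as weak convergence tested against bounded continuous functions. -/
def TendstoInDistribution {Ω : Type*} [MeasurableSpace Ω] (μ : Measure Ω)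
    (f : ℕ → Ω → ℝ) (ν : Measure ℝ) : Prop :=
  ∀ g : BoundedContinuousFunction ℝ ℝ,
    Tendsto (fun n => ∫ ω, g (f n ω) ∂μ) atTop (𝓝 (∫ x, g x ∂ν))

/-- Mean square convergence implies convergence of the integrals of bounded continuous functions. -/
lemma tendsto_integral_comp_of_tendsto_integral_sq {Ω : Type*} [MeasurableSpace Ω]
    {μ : Measure Ω} [IsProbabilityMeasure μ] {f : ℕ → Ω → ℝ} {Y : Ω → ℝ}
    (hf : ∀ n, Measurable (f n)) (hY : Measurable Y)
    (hL : ∀ n, MemLp (f n - Y) 2 μ)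
    (h : Tendsto (fun n => ∫ ω, (f n ω - Y ω) ^ 2 ∂μ) atTop (𝓝 0))
    (g : BoundedContinuousFunction ℝ ℝ) :
    Tendsto (fun n => ∫ ω, g (f n ω) ∂μ) atTop (𝓝 (∫ ω, g (Y ω) ∂μ)) := by
  have hm : TendstoInMeasure μ f atTop Y := by
    refine tendstoInMeasure_of_tendsto_eLpNorm (p := 2) two_ne_zero
      (fun n => (hf n).aestronglyMeasurable) hY.aestronglyMeasurable ?_
    have hrw : ∀ n, eLpNorm (f n - Y) 2 μ
        = ENNReal.ofReal (√(∫ ω, (f n ω - Y ω) ^ 2 ∂μ)) := fun n => by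
      rw [(hL n).eLpNorm_eq_integral_rpow_norm two_ne_zero ENNReal.ofNat_ne_top, Real.sqrt_eq_rpow]
      simp
    simp_rw [hrw]
    simpa using ENNReal.tendsto_ofReal h.sqrt
  have hd := (hm.tendstoInDistribution fun n => (hf n).aemeasurable).tendsto
  have hg := ProbabilityMeasure.tendsto_iff_forall_integral_tendsto.1 hd g
  simp only [ProbabilityMeasure.coe_mk] at hg
  rw [integral_map hY.aemeasurable g.continuous.aestronglyMeasurable] at hg
  refine hg.congr fun n => ?_
  rw [integral_map (hf n).aemeasurable g.continuous.aestronglyMeasurable]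

/-- A weakly convergent sequence of random variables with values in `[-1, 1]` has convergent
moments. -/
lemma tendsto_integral_pow_of_abs_le_one {Ω : Type*} [MeasurableSpace Ω]
    {μ : Measure Ω} {f : ℕ → Ω → ℝ} {ν : Measure ℝ} (h : _root_.TendstoInDistribution μ f ν)
    (hf : ∀ n, ∀ᵐ ω ∂μ, |f n ω| ≤ 1) (k : ℕ) :
    Tendsto (fun n => ∫ ω, f n ω ^ k ∂μ) atTop (𝓝 (∫ x, (max (-1) (min x 1)) ^ k ∂ν)) := by
  let g : BoundedContinuousFunction ℝ ℝ :=
    BoundedContinuousFunction.ofNormedAddCommGroup (fun x => (max (-1) (min x 1)) ^ k)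
      (by fun_prop) 1 fun x => by
        rw [norm_pow, Real.norm_eq_abs]
        exact pow_le_one₀ (abs_nonneg _)
          (abs_le.2 ⟨le_max_left _ _, max_le (by norm_num) (min_le_right _ _)⟩)
  refine (h g).congr fun n => integral_congr_ae ?_
  filter_upwards [hf n] with ω hω
  rw [abs_le] at hω
  simp [g, min_eq_left hω.2, max_eq_right hω.1]

/-- The tower property combined with the pull-out property. -/
lemma integral_mul_eq_of_condExp_ae_eq {Ω : Type*} {m m0 : MeasurableSpace Ω}
    {μ : Measure Ω} [IsFiniteMeasure μ] (hm : m ≤ m0) {f X Y : Ω → ℝ}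
    (hf : Measurable[m] f) (hfX : Integrable (f * X) μ) (hX : Integrable X μ)
    (h : μ[X | m] =ᵐ[μ] Y) :
    ∫ ω, f ω * X ω ∂μ = ∫ ω, f ω * Y ω ∂μ := by
  calc ∫ ω, f ω * X ω ∂μ = ∫ ω, (μ[f * X | m]) ω ∂μ := (integral_condExp hm).symm
    _ = ∫ ω, f ω * Y ω ∂μ := integral_congr_ae <| by
      filter_upwards [condExp_mul_of_stronglyMeasurable_left hf.stronglyMeasurable hfX hX, h]
        with ω h1 h2
      simp [h1, h2]

lemma sigmaUpTo_le {Ω : Type*} [m0 : MeasurableSpace Ω] {X : ℕ → Ω → ℝ}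
    (hX : ∀ i, Measurable (X i)) (n : ℕ) : sigmaUpTo X n ≤ m0 :=
  iSup₂_le fun i _ => (hX i).comap_le

lemma measurable_sigmaUpTo {Ω : Type*} (X : ℕ → Ω → ℝ) {i n : ℕ} (hi : 1 ≤ i) (hin : i ≤ n) :
    Measurable[sigmaUpTo X n] (X i) :=
  (comap_measurable (X i)).mono
    (le_iSup₂ (f := fun i (_ : i ∈ Finset.Icc 1 n) => MeasurableSpace.comap (X i) inferInstance)
      i (Finset.mem_Icc.2 ⟨hi, hin⟩)) le_rfl

lemma measurable_partialSum {Ω : Type*} (X : ℕ → Ω → ℝ) (n : ℕ) :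
    Measurable[sigmaUpTo X n] (partialSum X n) :=
  Finset.measurable_fun_sum _ fun _ hi =>
    measurable_sigmaUpTo X (Finset.mem_Icc.1 hi).1 (Finset.mem_Icc.1 hi).2

lemma partialSum_succ {Ω : Type*} (X : ℕ → Ω → ℝ) (n : ℕ) (ω : Ω) :
    partialSum X (n + 1) ω = partialSum X n ω + X (n + 1) ω :=
  Finset.sum_Icc_succ_top (by omega) _

lemma abs_partialSum_le {Ω : Type*} {X : ℕ → Ω → ℝ} {ω : Ω}
    (h : ∀ i, 1 ≤ i → X i ω = 1 ∨ X i ω = -1) (n : ℕ) : |partialSum X n ω| ≤ n := by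
  refine (Finset.abs_sum_le_sum_abs _ _).trans ?_
  calc ∑ k ∈ Finset.Icc 1 n, |X k ω| ≤ ∑ k ∈ Finset.Icc 1 n, (1 : ℝ) :=
        Finset.sum_le_sum fun k hk => by
          rcases h k (Finset.mem_Icc.1 hk).1 with h | h <;> simp [h]
    _ = n := by simp

/-- The expectation of a `±1`-valued random variable. -/
lemma integral_of_sign_valued {Ω : Type*} [MeasurableSpace Ω] {μ : Measure Ω}
    [IsProbabilityMeasure μ] {X : Ω → ℝ} (hX : Measurable X)
    (hval : ∀ᵐ ω ∂μ, X ω = 1 ∨ X ω = -1) :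
    ∫ ω, X ω ∂μ = 2 * μ.real {ω | X ω = 1} - 1 := by
  have hs : MeasurableSet {ω | X ω = 1} := hX (measurableSet_singleton 1)
  calc ∫ ω, X ω ∂μ = ∫ ω, (2 * {ω | X ω = 1}.indicator (fun _ => (1 : ℝ)) ω - 1) ∂μ :=
        integral_congr_ae <| by
          filter_upwards [hval] with ω hω
          rcases hω with hω | hω <;> norm_num [Set.indicator, hω]
    _ = 2 * μ.real {ω | X ω = 1} - 1 := by
      rw [integral_sub (((integrable_const _).indicator hs).const_mul _) (integrable_const _),
        integral_const_mul, integral_indicator_const _ hs]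
      simp

/-- Integral against a combination of three Dirac masses. -/
lemma integral_three_dirac {a b c : ℝ} (ha : 0 ≤ a) (hb : 0 ≤ b) (hc : 0 ≤ c) (x y z : ℝ)
    (g : ℝ → ℝ) :
    ∫ t, g t ∂(ENNReal.ofReal a • Measure.dirac x + ENNReal.ofReal b • Measure.dirac y +
      ENNReal.ofReal c • Measure.dirac z) = a * g x + b * g y + c * g z := by
  have hi : ∀ (r t : ℝ), Integrable g (ENNReal.ofReal r • Measure.dirac t) := fun r t =>
    (integrable_dirac (by finiteness)).smul_measure ENNReal.ofReal_ne_top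
  rw [integral_add_measure ((hi _ _).add_measure (hi _ _)) (hi _ _),
    integral_add_measure (hi _ _) (hi _ _)]
  simp [integral_smul_measure, ha, hb, hc]

/-- Expectation of a function of the sum of two `±1`-valued random variables in terms of their
means and correlation. -/
lemma integral_comp_add_of_sign_valued {Ω : Type*} [MeasurableSpace Ω] {μ : Measure Ω}
    [IsProbabilityMeasure μ] {X Y : Ω → ℝ} (hX : Measurable X) (hY : Measurable Y)
    (hX1 : ∀ᵐ ω ∂μ, X ω = 1 ∨ X ω = -1) (hY1 : ∀ᵐ ω ∂μ, Y ω = 1 ∨ Y ω = -1) (g : ℝ → ℝ) :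
    ∫ ω, g (X ω + Y ω) ∂μ =
      (1 + ∫ ω, X ω ∂μ + ∫ ω, Y ω ∂μ + ∫ ω, X ω * Y ω ∂μ) / 4 * g 2 +
      (1 - ∫ ω, X ω * Y ω ∂μ) / 2 * g 0 +
      (1 - ∫ ω, X ω ∂μ - ∫ ω, Y ω ∂μ + ∫ ω, X ω * Y ω ∂μ) / 4 * g (-2) := by
  have hiX : Integrable X μ := .of_bound hX.aestronglyMeasurable 1 <| by
    filter_upwards [hX1] with ω h
    rcases h with h | h <;> simp [h]
  have hiY : Integrable Y μ := .of_bound hY.aestronglyMeasurable 1 <| by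
    filter_upwards [hY1] with ω h
    rcases h with h | h <;> simp [h]
  have hiXY : Integrable (fun ω => X ω * Y ω) μ :=
    .of_bound (hX.mul hY).aestronglyMeasurable 1 <| by
      filter_upwards [hX1, hY1] with ω h h'
      rcases h with h | h <;> rcases h' with h' | h' <;> simp [h, h']
  calc ∫ ω, g (X ω + Y ω) ∂μ
      = ∫ ω, ((g 2 / 4 + g 0 / 2 + g (-2) / 4) + (g 2 / 4 - g (-2) / 4) * X ω +
          (g 2 / 4 - g (-2) / 4) * Y ω +
          (g 2 / 4 - g 0 / 2 + g (-2) / 4) * (X ω * Y ω)) ∂μ := integral_congr_ae <| by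
        filter_upwards [hX1, hY1] with ω h h'
        rcases h with h | h <;> rcases h' with h' | h' <;> norm_num [h, h'] <;> ring
    _ = _ := by
      rw [integral_add (by fun_prop) (by fun_prop), integral_add (by fun_prop) (by fun_prop),
        integral_add (by fun_prop) (by fun_prop)]
      simp only [integral_const_mul, integral_const, probReal_univ, one_smul]
      ring

/-- If `Y` is a bounded version of every conditional expectation `E[X (n+1) | X 1, …, X n]` with
`n ≥ 2`, then `partialSum X n - n * Y` has second moment of order `n`. -/
lemma integral_sq_partialSum_sub_le {Ω : Type*} [MeasurableSpace Ω] {μ : Measure Ω}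
    [IsProbabilityMeasure μ] {X : ℕ → Ω → ℝ} {Y : Ω → ℝ} (hX : ∀ i, Measurable (X i))
    (hval : ∀ᵐ ω ∂μ, ∀ i, 1 ≤ i → X i ω = 1 ∨ X i ω = -1)
    (hY : Measurable[sigmaUpTo X 2] Y) (hY1 : ∀ᵐ ω ∂μ, |Y ω| ≤ 1)
    (hcond : ∀ n, 2 ≤ n → μ[X (n + 1) | sigmaUpTo X n] =ᵐ[μ] Y) {n : ℕ} (hn : 2 ≤ n) :
    ∫ ω, (partialSum X n ω - n * Y ω) ^ 2 ∂μ ≤ 4 * n + 8 := by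
  have hYm : Measurable Y := hY.mono (sigmaUpTo_le hX 2) le_rfl
  have hSm : ∀ n, Measurable (partialSum X n) := fun n =>
    (measurable_partialSum X n).mono (sigmaUpTo_le hX n) le_rfl
  have hT : ∀ n, ∀ᵐ ω ∂μ, |partialSum X n ω - n * Y ω| ≤ 2 * n := fun n => by
    filter_upwards [hval, hY1] with ω h h'
    have := abs_partialSum_le h n
    have hn : (0 : ℝ) ≤ n := n.cast_nonneg
    rw [abs_le] at *
    constructor <;> nlinarith
  have hD : ∀ n, ∀ᵐ ω ∂μ, |X (n + 1) ω - Y ω| ≤ 2 := fun n => by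
    filter_upwards [hval, hY1] with ω h h'
    rw [abs_le] at *
    rcases h (n + 1) (by omega) with h | h <;> rw [h] <;> constructor <;> linarith
  induction n, hn using Nat.le_induction with
  | base =>
    have : ∀ᵐ ω ∂μ, (partialSum X 2 ω - (2 : ℕ) * Y ω) ^ 2 ≤ 16 := by
      filter_upwards [hT 2] with ω h
      rw [← sq_abs]
      push_cast at *
      nlinarith [abs_nonneg (partialSum X 2 ω - 2 * Y ω)]
    calc _ ≤ ∫ _, (16 : ℝ) ∂μ := integral_mono_of_nonneg
            (ae_of_all _ fun _ => sq_nonneg _) (integrable_const _) this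
      _ = _ := by norm_num
  | succ n hn ih =>
    have hTX : Integrable ((fun ω => partialSum X n ω - n * Y ω) * X (n + 1)) μ :=
      .of_bound (by fun_prop) (2 * n) <| by
        filter_upwards [hT n, hval] with ω h h'
        rcases h' (n + 1) (by omega) with h' | h' <;>
          simpa only [Pi.mul_apply, h', mul_one, mul_neg, norm_neg, Real.norm_eq_abs] using h
    have hXi : Integrable (X (n + 1)) μ := .of_bound (by fun_prop) 1 <| by
      filter_upwards [hval] with ω h'
      rcases h' (n + 1) (by omega) with h' | h' <;> simp [h']
    have hTY : Integrable (fun ω => (partialSum X n ω - n * Y ω) * Y ω) μ :=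
      .of_bound (by fun_prop) (2 * n * 1) <| by
        filter_upwards [hT n, hY1] with ω h h'
        rw [norm_mul]
        exact mul_le_mul h h' (abs_nonneg _) (by positivity)
    have hTT : Integrable (fun ω => (partialSum X n ω - n * Y ω) ^ 2) μ :=
      .of_bound (by fun_prop) ((2 * n) ^ 2) <| by
        filter_upwards [hT n] with ω h
        rw [norm_pow]
        exact pow_le_pow_left₀ (norm_nonneg _) h 2
    have hdiff : Integrable (fun ω => 2 * ((partialSum X n ω - n * Y ω) * X (n + 1) ω -
        (partialSum X n ω - n * Y ω) * Y ω)) μ := (hTX.sub hTY).const_mul 2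
    have hsum : Integrable (fun ω => (partialSum X n ω - n * Y ω) ^ 2 +
        2 * ((partialSum X n ω - n * Y ω) * X (n + 1) ω -
          (partialSum X n ω - n * Y ω) * Y ω)) μ := hTT.add hdiff
    have hle : sigmaUpTo X 2 ≤ sigmaUpTo X n :=
      biSup_mono fun i hi => Finset.Icc_subset_Icc_right hn hi
    have hYn : Measurable[sigmaUpTo X n] Y := hY.mono hle le_rfl
    have horth := integral_mul_eq_of_condExp_ae_eq (sigmaUpTo_le hX n)
      ((measurable_partialSum X n).sub (hYn.const_mul (n : ℝ))) hTX hXi (hcond n hn)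
    simp only [Pi.sub_apply] at horth
    calc ∫ ω, (partialSum X (n + 1) ω - (n + 1 : ℕ) * Y ω) ^ 2 ∂μ
        ≤ ∫ ω, ((partialSum X n ω - n * Y ω) ^ 2 +
            2 * ((partialSum X n ω - n * Y ω) * X (n + 1) ω -
              (partialSum X n ω - n * Y ω) * Y ω) + 4) ∂μ := by
          refine integral_mono_of_nonneg (ae_of_all _ fun _ => sq_nonneg _)
            (hsum.add (integrable_const 4)) ?_
          filter_upwards [hD n] with ω h
          have : (X (n + 1) ω - Y ω) ^ 2 ≤ 2 ^ 2 := sq_le_sq.2 (by simpa using h)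
          rw [partialSum_succ]
          push_cast
          linarith
      _ = ∫ ω, (partialSum X n ω - n * Y ω) ^ 2 ∂μ + 4 := by
          rw [integral_add hsum (integrable_const 4), integral_add hTT hdiff,
            integral_const_mul, integral_sub (f := fun ω => _ * X (n + 1) ω) hTX hTY, horth]
          simp
      _ ≤ 4 * (n + 1 : ℕ) + 8 := by push_cast; linarith

/-- for the elephant random walk remembering only the first two steps:
(a) `Sₙ/n` converges in distribution to the three-point law with mass `p²` at `2p-1`,
mass `1-p` at `0` and mass `p(1-p)` at `-(2p-1)`; (b) `E(Sₙ/n) → p(2p-1)²` and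
`Var(Sₙ/n) → p(1-p)(2p-1)²(4p²+1)`. -/
theorem elephant_first_two_steps_lln
    {Ω : Type*} [MeasurableSpace Ω] (μ : Measure Ω) [IsProbabilityMeasure μ]
    (p : ℝ) (hp0 : 0 < p) (hp1 : p < 1)
    (X : ℕ → Ω → ℝ)
    (hXmeas : ∀ i, Measurable (X i))
    (hval : ∀ i, 1 ≤ i → ∀ᵐ ω ∂μ, X i ω = 1 ∨ X i ω = -1)
    (hinit : μ {ω | X 1 ω = 1} = ENNReal.ofReal p)
    (hcond1 : μ[X 2 | sigmaUpTo X 1] =ᵐ[μ] fun ω => (2*p-1) * X 1 ω)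
    (hcond : ∀ n, 2 ≤ n →
      μ[X (n+1) | sigmaUpTo X n] =ᵐ[μ] fun ω => (2*p-1) * (X 1 ω + X 2 ω) / 2) :
    TendstoInDistribution μ (fun n ω => partialSum X n ω / n)
      (ENNReal.ofReal (p^2) • Measure.dirac (2*p-1) +
        ENNReal.ofReal (1-p) • Measure.dirac 0 +
        ENNReal.ofReal (p*(1-p)) • Measure.dirac (-(2*p-1))) ∧
    Tendsto (fun n : ℕ => ∫ ω, partialSum X n ω / n ∂μ) atTop (𝓝 (p*(2*p-1)^2)) ∧
    Tendsto (fun n : ℕ => variance (fun ω => partialSum X n ω / n) μ) atTop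
      (𝓝 (p*(1-p)*(2*p-1)^2*(4*p^2+1))) := by
  have hall : ∀ᵐ ω ∂μ, ∀ i, 1 ≤ i → X i ω = 1 ∨ X i ω = -1 :=
    ae_all_iff.2 fun i => eventually_imp_distrib_left.2 (hval i)
  have hSm : ∀ n, Measurable (partialSum X n) := fun n =>
    (measurable_partialSum X n).mono (sigmaUpTo_le hXmeas n) le_rfl
  have hS1 : ∀ n : ℕ, ∀ᵐ ω ∂μ, |partialSum X n ω / n| ≤ 1 := fun n => by
    filter_upwards [hall] with ω h
    rw [abs_div, Nat.abs_cast]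
    exact div_le_one_of_le₀ (abs_partialSum_le h n) n.cast_nonneg
  set Y : Ω → ℝ := fun ω => (2*p-1) * (X 1 ω + X 2 ω) / 2 with hYdef
  have hY2 : Measurable[sigmaUpTo X 2] Y :=
    (((measurable_sigmaUpTo X le_rfl one_le_two).add
      (measurable_sigmaUpTo X one_le_two le_rfl)).const_mul _).div_const _
  have hYm : Measurable Y := hY2.mono (sigmaUpTo_le hXmeas 2) le_rfl
  have hY1 : ∀ᵐ ω ∂μ, |Y ω| ≤ 1 := by
    filter_upwards [hall] with ω h
    rw [abs_le]
    rcases h 1 le_rfl with h1 | h1 <;> rcases h 2 one_le_two with h2 | h2 <;>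
      simp only [Y, h1, h2] <;> constructor <;> linarith
  have hlim : Tendsto (fun n : ℕ => ∫ ω, (partialSum X n ω / n - Y ω) ^ 2 ∂μ) atTop (𝓝 0) := by
    have hb : Tendsto (fun n : ℕ => 8 / (n : ℝ)) atTop (𝓝 0) :=
      tendsto_const_div_atTop_nhds_zero_nat 8
    refine squeeze_zero' (.of_forall fun n => integral_nonneg fun ω => sq_nonneg _) ?_ hb
    filter_upwards [eventually_ge_atTop 2] with n hn
    have hn2 : (2 : ℝ) ≤ n := by exact_mod_cast hn
    have hn0 : (n : ℝ) ≠ 0 := by positivity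
    have hrw : ∀ ω, (partialSum X n ω / n - Y ω) ^ 2 =
        (partialSum X n ω - n * Y ω) ^ 2 / (n : ℝ) ^ 2 := fun ω => by field_simp
    simp_rw [hrw, integral_div]
    rw [div_le_div_iff₀ (by positivity) (by positivity)]
    have := integral_sq_partialSum_sub_le hXmeas hall hY2 hY1 hcond hn
    nlinarith
  have hp : 2 * μ.real {ω | X 1 ω = 1} - 1 = 2 * p - 1 := by
    rw [measureReal_def, hinit, ENNReal.toReal_ofReal hp0.le]
  have hE1 : ∫ ω, X 1 ω ∂μ = 2*p-1 := by
    rw [integral_of_sign_valued (hXmeas 1) (hval 1 le_rfl), hp]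
  have hi2 : Integrable (X 2) μ := .of_bound (hXmeas 2).aestronglyMeasurable 1 <| by
    filter_upwards [hval 2 one_le_two] with ω h
    rcases h with h | h <;> simp [h]
  have hi12 : Integrable (X 1 * X 2) μ :=
    .of_bound ((hXmeas 1).mul (hXmeas 2)).aestronglyMeasurable 1 <| by
      filter_upwards [hval 1 le_rfl, hval 2 one_le_two] with ω h h'
      rcases h with h | h <;> rcases h' with h' | h' <;> simp [h, h']
  have hE2 : ∫ ω, X 2 ω ∂μ = (2*p-1)^2 := by
    rw [← integral_condExp (sigmaUpTo_le hXmeas 1), integral_congr_ae hcond1,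
      integral_const_mul, hE1, sq]
  have hE12 : ∫ ω, X 1 ω * X 2 ω ∂μ = 2*p-1 := by
    rw [integral_mul_eq_of_condExp_ae_eq (sigmaUpTo_le hXmeas 1)
      (measurable_sigmaUpTo X le_rfl le_rfl) hi12 hi2 hcond1]
    calc ∫ ω, X 1 ω * ((2*p-1) * X 1 ω) ∂μ = ∫ _, (2*p-1) ∂μ := integral_congr_ae <| by
          filter_upwards [hval 1 le_rfl] with ω h
          rcases h with h | h <;> simp [h]
      _ = 2*p-1 := by simp
  have hq : 0 ≤ 1 - p := by linarith
  have hpq : 0 ≤ p * (1 - p) := by positivity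
  have hdist : _root_.TendstoInDistribution μ (fun n ω => partialSum X n ω / n)
      (ENNReal.ofReal (p^2) • Measure.dirac (2*p-1) +
        ENNReal.ofReal (1-p) • Measure.dirac 0 +
        ENNReal.ofReal (p*(1-p)) • Measure.dirac (-(2*p-1))) := by
    intro g
    rw [integral_three_dirac (sq_nonneg p) hq hpq]
    convert tendsto_integral_comp_of_tendsto_integral_sq
      (fun n => (hSm n).div_const (n : ℝ)) hYm (fun n => ?_) hlim g using 2
    · rw [integral_comp_add_of_sign_valued (hXmeas 1) (hXmeas 2) (hval 1 le_rfl)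
        (hval 2 one_le_two) (fun t => g ((2*p-1) * t / 2)), hE1, hE2, hE12]
      ring_nf
    · refine .of_bound (((hSm n).div_const _).sub hYm).aestronglyMeasurable 2 ?_
      filter_upwards [hS1 n, hY1] with ω h h'
      exact (norm_sub_le _ _).trans ((add_le_add h h').trans (by norm_num))
  have hmom := tendsto_integral_pow_of_abs_le_one hdist hS1
  simp only [integral_three_dirac (sq_nonneg p) hq hpq] at hmom
  have hc : max (-1) (min (2*p-1) 1) = 2*p-1 := by
    rw [min_eq_left (by linarith), max_eq_right (by linarith)]
  have hc' : max (-1) (min (-(2*p-1)) 1) = -(2*p-1) := by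
    rw [min_eq_left (by linarith), max_eq_right (by linarith)]
  have hc0 : max (-1) (min (0 : ℝ) 1) = 0 := by norm_num
  simp only [hc, hc', hc0] at hmom
  have hmean : Tendsto (fun n : ℕ => ∫ ω, partialSum X n ω / n ∂μ) atTop (𝓝 (p*(2*p-1)^2)) := by
    convert hmom 1 using 2
    · simp
    · ring
  refine ⟨hdist, hmean, ?_⟩
  have hvar : ∀ n : ℕ, variance (fun ω => partialSum X n ω / n) μ =
      ∫ ω, (partialSum X n ω / n) ^ 2 ∂μ - (∫ ω, partialSum X n ω / n ∂μ) ^ 2 := fun n =>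
    variance_eq_sub (.of_bound ((hSm n).div_const _).aestronglyMeasurable 1 (hS1 n))
  simp_rw [hvar]
  convert (hmom 2).sub (hmean.pow 2) using 2
  ring
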